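/- arXiv:2602.11031 — 2 statements merged into one kernel-verified Lean document; each statement's English description precedes it below -/
import Mathlib

section
/- For all β₁, β₂ ∈ ℤ[1/n] and c₁, c₂ ∈ ℤ with c₂ ≠ 0, the composite endomorphism of BS(1,n) obtained by first applying ψ^{II}_{β₁,c₁} and then applying ψ^{II}_{β₂,c₂} equals ψ^{II}_{μβ₂, c₁c₂}, where μ = (n^{c₁c₂} − 1)/(n^{c₂} − 1) ∈ ℤ[1/n]. -/
/-- The defining relator set of the Baumslag–Solitar group `BS(1,n)`:
generators `false ↦ a`, `true ↦ t`, relator `t⁻¹ aⁿ t a⁻¹`. -/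
def bsRels (n : ℤ) : Set (FreeGroup Bool) :=
  {(FreeGroup.of true)⁻¹ * (FreeGroup.of false) ^ n * FreeGroup.of true * (FreeGroup.of false)⁻¹}

/-- The solvable Baumslag–Solitar group `BS(1,n) = ⟨a, t ∣ t⁻¹ aⁿ t = a⟩`. -/
abbrev BS (n : ℤ) := PresentedGroup (bsRels n)

/-- The generator `a` of `BS(1,n)`. -/
def BS.a (n : ℤ) : BS n := PresentedGroup.of false

/-- The generator `t` of `BS(1,n)`. -/
def BS.t (n : ℤ) : BS n := PresentedGroup.of true

/-- `ℤ[1/n]` as a set of rationals: those of the form `k / n^p`. -/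
def zInv (n : ℤ) : Set ℚ := {x : ℚ | ∃ (k : ℤ) (p : ℕ), x = (k : ℚ) / (n : ℚ) ^ p}

open Classical in
/-- For `α = k/n^p ∈ ℤ[1/n]`, the element `a^α := t⁻ᵖ aᵏ tᵖ` of `BS(1,n)`
(junk value `1` if `α ∉ ℤ[1/n]`). -/
noncomputable def apow (n : ℤ) (α : ℚ) : BS n :=
  if h : ∃ kp : ℤ × ℕ, α = (kp.1 : ℚ) / (n : ℚ) ^ kp.2 then
    BS.t n ^ (-(h.choose.2 : ℤ)) * BS.a n ^ h.choose.1 * BS.t n ^ (h.choose.2 : ℤ)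
  else 1

/-- `u` and `v` are `ψ`-twisted conjugate: `v = ψ(x)⁻¹ u x` for some `x`. -/
def twistedConj {G : Type*} [Group G] (ψ : G →* G) (u v : G) : Prop :=
  ∃ x : G, v = (ψ x)⁻¹ * u * x

namespace zInv

lemma exists_common_denom {n : ℤ} (hn : n ≠ 0) {x y : ℚ} (hx : x ∈ zInv n) (hy : y ∈ zInv n) :
    ∃ (k l : ℤ) (p : ℕ), x = (k : ℚ) / (n : ℚ) ^ p ∧ y = (l : ℚ) / (n : ℚ) ^ p := by
  obtain ⟨k, p, rfl⟩ := hx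
  obtain ⟨l, q, rfl⟩ := hy
  have hn' : (n : ℚ) ≠ 0 := by exact_mod_cast hn
  refine ⟨k * n ^ q, l * n ^ p, p + q, ?_, ?_⟩ <;> push_cast <;> rw [pow_add] <;> field_simp

lemma add_mem {n : ℤ} (hn : n ≠ 0) {x y : ℚ} (hx : x ∈ zInv n) (hy : y ∈ zInv n) :
    x + y ∈ zInv n := by
  obtain ⟨k, l, p, rfl, rfl⟩ := exists_common_denom hn hx hy
  exact ⟨k + l, p, by push_cast; ring⟩

lemma neg_mem {n : ℤ} {x : ℚ} (hx : x ∈ zInv n) : -x ∈ zInv n := by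
  obtain ⟨k, p, rfl⟩ := hx
  exact ⟨-k, p, by push_cast; ring⟩

lemma mul_mem {n : ℤ} {x y : ℚ} (hx : x ∈ zInv n) (hy : y ∈ zInv n) : x * y ∈ zInv n := by
  obtain ⟨k, p, rfl⟩ := hx
  obtain ⟨l, q, rfl⟩ := hy
  exact ⟨k * l, p + q, by push_cast; rw [pow_add, div_mul_div_comm]⟩

lemma zpow_mem (n c : ℤ) : (n : ℚ) ^ c ∈ zInv n := by
  obtain ⟨m, rfl | rfl⟩ := c.eq_nat_or_neg
  · exact ⟨n ^ m, 0, by simp⟩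
  · exact ⟨1, m, by simp⟩

lemma geom_mem {n : ℤ} (hn : n ≠ 0) {q : ℚ} (hq : ∀ m : ℤ, q ^ m ∈ zInv n) (hq0 : q ≠ 0)
    (hq1 : q ≠ 1) (m : ℤ) : (q ^ m - 1) / (q - 1) ∈ zInv n := by
  have hq1' : q - 1 ≠ 0 := sub_ne_zero.mpr hq1
  induction m using Int.induction_on with
  | zero => exact ⟨0, 0, by simp⟩
  | succ i ih =>
    convert add_mem hn ih (hq i) using 1
    rw [zpow_add_one₀ hq0]
    field_simp
    ring
  | pred i ih =>
    convert add_mem hn ih (neg_mem (hq (-i - 1))) using 1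
    have h : q ^ (-i : ℤ) = q ^ (-i - 1 : ℤ) * q := by rw [← zpow_add_one₀ hq0]; simp
    rw [h]
    field_simp
    ring

end zInv

namespace BS

lemma t_mul_a_mul_inv (n : ℤ) : t n * a n * (t n)⁻¹ = a n ^ n := by
  have h : (t n)⁻¹ * a n ^ n * t n * (a n)⁻¹ = 1 :=
    PresentedGroup.one_of_mem (rels := bsRels n) rfl
  nth_rw 1 [← mul_inv_eq_one.mp h]
  group

lemma t_mul_zpow_mul_inv (n k : ℤ) : t n * a n ^ k * (t n)⁻¹ = a n ^ (n * k) := by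
  rw [← conj_zpow, t_mul_a_mul_inv, zpow_mul]

lemma t_pow_mul_zpow_mul_inv (n k : ℤ) (j : ℕ) :
    t n ^ j * a n ^ k * (t n ^ j)⁻¹ = a n ^ (n ^ j * k) := by
  induction j with
  | zero => simp
  | succ j ih =>
    rw [pow_succ' n, mul_assoc n, ← t_mul_zpow_mul_inv, ← ih, pow_succ']
    group

lemma conj_zpow_add (n k : ℤ) (p j : ℕ) :
    (t n ^ (p + j))⁻¹ * a n ^ (n ^ j * k) * t n ^ (p + j) =
      (t n ^ p)⁻¹ * a n ^ k * t n ^ p := by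
  rw [← t_pow_mul_zpow_mul_inv, pow_add]
  have h := (Commute.refl (t n)).pow_pow p j
  rw [h.eq]
  group

end BS

lemma apow_div_pow {n : ℤ} (hn : n ≠ 0) (k : ℤ) (p : ℕ) :
    apow n ((k : ℚ) / (n : ℚ) ^ p) = (BS.t n ^ p)⁻¹ * BS.a n ^ k * BS.t n ^ p := by
  have h : ∃ kp : ℤ × ℕ, (k : ℚ) / (n : ℚ) ^ p = (kp.1 : ℚ) / (n : ℚ) ^ kp.2 := ⟨(k, p), rfl⟩
  have hn' : (n : ℚ) ≠ 0 := by exact_mod_cast hn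
  rw [apow, dif_pos h]
  have hc := h.choose_spec
  generalize h.choose = kp at hc ⊢
  obtain ⟨l, q⟩ := kp
  have hkl : n ^ q * k = n ^ p * l := by
    rw [div_eq_div_iff (by positivity) (by positivity)] at hc
    have : (k : ℚ) * n ^ q = l * n ^ p := hc
    norm_cast at this
    linarith
  rw [← BS.conj_zpow_add n k p q, hkl, add_comm p q, BS.conj_zpow_add]
  simp

lemma apow_zero {n : ℤ} (hn : n ≠ 0) : apow n 0 = 1 := by
  simpa using apow_div_pow hn 0 0

lemma apow_add {n : ℤ} (hn : n ≠ 0) {x y : ℚ} (hx : x ∈ zInv n) (hy : y ∈ zInv n) :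
    apow n (x + y) = apow n x * apow n y := by
  obtain ⟨k, l, p, rfl, rfl⟩ := zInv.exists_common_denom hn hx hy
  rw [← add_div, ← Int.cast_add, apow_div_pow hn, apow_div_pow hn, apow_div_pow hn, zpow_add]
  group

lemma t_conj_apow {n : ℤ} (hn : n ≠ 0) {x : ℚ} (hx : x ∈ zInv n) :
    BS.t n * apow n x * (BS.t n)⁻¹ = apow n (n * x) := by
  obtain ⟨k, p, rfl⟩ := hx
  rw [← mul_div_assoc, ← Int.cast_mul, apow_div_pow hn, apow_div_pow hn,
    ← BS.t_mul_zpow_mul_inv]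
  group

lemma t_zpow_conj_apow {n : ℤ} (hn : n ≠ 0) {x : ℚ} (hx : x ∈ zInv n) (c : ℤ) :
    BS.t n ^ c * apow n x * (BS.t n ^ c)⁻¹ = apow n ((n : ℚ) ^ c * x) := by
  have hn' : (n : ℚ) ≠ 0 := by exact_mod_cast hn
  induction c using Int.induction_on with
  | zero => simp
  | succ i ih =>
    rw [add_comm, zpow_one_add₀ hn', mul_assoc (n : ℚ),
      ← t_conj_apow hn (zInv.mul_mem (zInv.zpow_mem n i) hx), ← ih]
    group
  | pred i ih =>
    have h := t_conj_apow hn (zInv.mul_mem (zInv.zpow_mem n (-i - 1)) hx)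
    rw [← mul_assoc, ← zpow_one_add₀ hn', add_sub_cancel, ← ih] at h
    rw [← mul_right_inj (BS.t n), ← mul_left_inj (BS.t n)⁻¹, h]
    group

lemma apow_mul_t_zpow_zpow {n : ℤ} (hn : n ≠ 0) {x : ℚ} (hx : x ∈ zInv n) {c : ℤ}
    (hc : (n : ℚ) ^ c ≠ 1) (m : ℤ) :
    (apow n x * BS.t n ^ c) ^ m =
      apow n ((((n : ℚ) ^ c) ^ m - 1) / ((n : ℚ) ^ c - 1) * x) * BS.t n ^ (c * m) := by
  have hn' : (n : ℚ) ≠ 0 := by exact_mod_cast hn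
  have hq0 : (n : ℚ) ^ c ≠ 0 := zpow_ne_zero c hn'
  have hq1 : (n : ℚ) ^ c - 1 ≠ 0 := sub_ne_zero.mpr hc
  have hq (m : ℤ) : ((n : ℚ) ^ c) ^ m ∈ zInv n := by
    rw [← zpow_mul]
    exact zInv.zpow_mem n _
  have hstep (m : ℤ) :
      apow n ((((n : ℚ) ^ c) ^ (m + 1) - 1) / ((n : ℚ) ^ c - 1) * x) * BS.t n ^ (c * (m + 1)) =
      apow n ((((n : ℚ) ^ c) ^ m - 1) / ((n : ℚ) ^ c - 1) * x) * BS.t n ^ (c * m) *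
        (apow n x * BS.t n ^ c) := by
    have h : (((n : ℚ) ^ c) ^ (m + 1) - 1) / ((n : ℚ) ^ c - 1) * x =
        (((n : ℚ) ^ c) ^ m - 1) / ((n : ℚ) ^ c - 1) * x + (n : ℚ) ^ (c * m) * x := by
      rw [zpow_add_one₀ hq0, zpow_mul]
      field_simp
      ring
    rw [h, apow_add hn (zInv.mul_mem (zInv.geom_mem hn hq hq0 hc m) hx)
      (zInv.mul_mem (zInv.zpow_mem n _) hx), ← t_zpow_conj_apow hn hx, mul_add, mul_one, zpow_add]
    group
  induction m using Int.induction_on with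
  | zero => simp [apow_zero hn]
  | succ i ih => rw [hstep, ← ih, zpow_add_one]
  | pred i ih =>
    have h := hstep (-i - 1)
    rw [sub_add_cancel, ← ih] at h
    rw [zpow_sub_one, h, mul_inv_cancel_right]

lemma map_apow_eq_one {n : ℤ} (hn : n ≠ 0) {G : Type*} [Group G] (ψ : BS n →* G)
    (hψ : ψ (BS.a n) = 1) {x : ℚ} (hx : x ∈ zInv n) : ψ (apow n x) = 1 := by
  obtain ⟨k, p, rfl⟩ := hx
  simp [apow_div_pow hn, hψ]

lemma intCast_zpow_ne_one {n : ℤ} (hn : n ∉ ({0, 1, -1} : Set ℤ)) {c : ℤ} (hc : c ≠ 0) :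
    (n : ℚ) ^ c ≠ 1 := by
  simp only [Set.mem_insert_iff, Set.mem_singleton_iff, not_or] at hn
  intro h
  rcases (zpow_eq_one_iff_cases₀).mp h with h | h | ⟨h, -⟩
  · exact hc h
  · exact hn.2.1 (by exact_mod_cast h)
  · exact hn.2.2 (by exact_mod_cast h)

/-- the composite of ψ^{II}_{β₁,c₁} followed by ψ^{II}_{β₂,c₂} (c₂ ≠ 0) is
ψ^{II}_{μβ₂, c₁c₂} where μ = (n^{c₁c₂}−1)/(n^{c₂}−1) ∈ ℤ[1/n]. -/
theorem comp_typeII_typeII (n : ℤ) (hn : n ∉ ({0, 1, -1} : Set ℤ))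
    (β₁ β₂ : ℚ) (hβ₁ : β₁ ∈ zInv n) (hβ₂ : β₂ ∈ zInv n)
    (c₁ c₂ : ℤ) (hc₂ : c₂ ≠ 0)
    (ψ₁ ψ₂ : BS n →* BS n)
    (h₁a : ψ₁ (BS.a n) = 1) (h₁t : ψ₁ (BS.t n) = apow n β₁ * BS.t n ^ c₁)
    (h₂a : ψ₂ (BS.a n) = 1) (h₂t : ψ₂ (BS.t n) = apow n β₂ * BS.t n ^ c₂) :
    ((n : ℚ) ^ (c₁ * c₂) - 1) / ((n : ℚ) ^ c₂ - 1) ∈ zInv n ∧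
    (ψ₂.comp ψ₁) (BS.a n) = 1 ∧
    (ψ₂.comp ψ₁) (BS.t n) =
      apow n (((n : ℚ) ^ (c₁ * c₂) - 1) / ((n : ℚ) ^ c₂ - 1) * β₂) * BS.t n ^ (c₁ * c₂) := by
  have hn0 : n ≠ 0 := fun h => hn (by simp [h])
  have hc := intCast_zpow_ne_one hn hc₂
  rw [mul_comm c₁ c₂, zpow_mul]
  refine ⟨zInv.geom_mem hn0 (fun m => ?_) (zpow_ne_zero _ (by exact_mod_cast hn0)) hc c₁,
    by simp [h₁a], ?_⟩
  · rw [← zpow_mul]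
    exact zInv.zpow_mem n _
  · rw [MonoidHom.comp_apply, h₁t, map_mul, map_apow_eq_one hn0 ψ₂ h₂a hβ₁, one_mul, map_zpow,
      h₂t, apow_mul_t_zpow_zpow hn0 hβ₂ hc]
end

section
/- Let k, j, ℓ, q, m₁, m₂, r ∈ ℤ with j, q, r ≥ 0, and set α = k/nʲ ∈ ℤ[1/n], β = ℓ/n^q ∈ ℤ[1/n]. Define the integers A = ℓ n^{r+j} + (n−1) m₁ n^{r+j+q}, B = (n−1)(nʲ − k) n^{r+q}, and C = (n−1) m₂ n^{j+q} + ℓ n^{r+j}. Then the elements a^{m₁} and t^{−r} a^{m₂} t^{r} of BS(1,n) are ψ^I_{α,β}-twisted conjugate if and only if there exist integers x, y, z with x ≥ 0 such that A·nˣ + B·y = C·n^z (an equality in ℚ, z possibly negative). -/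
namespace BS

variable {n : ℤ}

lemma t_inv_mul_a_zpow_mul_t (n : ℤ) : (t n)⁻¹ * a n ^ n * t n = a n := by
  have h : (PresentedGroup.mk (bsRels n)) ((FreeGroup.of true)⁻¹ * (FreeGroup.of false) ^ n *
      FreeGroup.of true * (FreeGroup.of false)⁻¹) = 1 :=
    PresentedGroup.one_of_mem rfl
  rw [map_mul, map_inv, mul_inv_eq_one] at h
  simp only [map_mul, map_inv, map_zpow] at h
  exact h

lemma t_mul_a_zpow (n k : ℤ) : t n * a n ^ k = a n ^ (n * k) * t n := by
  have h : t n * a n = a n ^ n * t n := by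
    conv_lhs => rw [← t_inv_mul_a_zpow_mul_t n]
    group
  rw [zpow_mul]
  exact (SemiconjBy.zpow_right h k)

lemma t_pow_mul_a_zpow (n k : ℤ) (p : ℕ) :
    t n ^ p * a n ^ k = a n ^ (n ^ p * k) * t n ^ p := by
  induction p with
  | zero => simp
  | succ p ih => rw [pow_succ', mul_assoc, ih, ← mul_assoc, t_mul_a_zpow, mul_assoc, ← pow_succ',
      ← mul_assoc, ← pow_succ']

lemma a_zpow_mul_t_pow_inv (n k : ℤ) (p : ℕ) :
    a n ^ k * (t n ^ p)⁻¹ = (t n ^ p)⁻¹ * a n ^ (n ^ p * k) := by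
  rw [mul_inv_eq_iff_eq_mul, mul_assoc, ← t_pow_mul_a_zpow, inv_mul_cancel_left]

lemma exists_eq_t_pow_inv_mul_a_zpow_mul_t_pow (g : BS n) :
    ∃ (p : ℕ) (k : ℤ) (s : ℕ), g = (t n ^ p)⁻¹ * a n ^ k * t n ^ s := by
  have hg : g ∈ Subgroup.closure (Set.range (PresentedGroup.of (rels := bsRels n))) := by
    rw [PresentedGroup.closure_range_of]
    exact Subgroup.mem_top g
  induction hg using Subgroup.closure_induction_left with
  | one => exact ⟨0, 0, 0, by simp⟩
  | mul_left x hx y _ ih =>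
    obtain ⟨b, rfl⟩ := hx
    obtain ⟨p, k, s, rfl⟩ := ih
    cases b
    · refine ⟨p, n ^ p * 1 + k, s, ?_⟩
      have := a_zpow_mul_t_pow_inv n 1 p
      rw [zpow_one] at this
      change a n * _ = _
      rw [← mul_assoc, ← mul_assoc, this, zpow_add, mul_assoc (t n ^ p)⁻¹]
    · change ∃ (p' : ℕ) (k' : ℤ) (s' : ℕ), t n * _ = _
      cases p with
      | zero =>
        refine ⟨0, n * k, s + 1, ?_⟩
        simp only [pow_zero, inv_one, one_mul]
        rw [← mul_assoc, t_mul_a_zpow, mul_assoc, pow_succ']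
      | succ p =>
        refine ⟨p, k, s, ?_⟩
        rw [pow_succ, mul_inv_rev]
        group
  | inv_mul_cancel x hx y _ ih =>
    obtain ⟨b, rfl⟩ := hx
    obtain ⟨p, k, s, rfl⟩ := ih
    cases b
    · refine ⟨p, n ^ p * (-1) + k, s, ?_⟩
      have := a_zpow_mul_t_pow_inv n (-1) p
      rw [zpow_neg_one] at this
      change (a n)⁻¹ * _ = _
      rw [← mul_assoc, ← mul_assoc, this, zpow_add, mul_assoc (t n ^ p)⁻¹]
    · refine ⟨p + 1, k, s, ?_⟩
      change (t n)⁻¹ * _ = _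
      rw [pow_succ, mul_inv_rev]
      group

end BS

lemma Equiv.Perm.zpow_apply_of_translation {f : Equiv.Perm ℚ} {b : ℚ} (hf : ∀ y, f y = y + b)
    (c : ℤ) (y : ℚ) : (f ^ c) y = y + c * b := by
  induction c generalizing y with
  | zero => simp
  | succ c ih => rw [zpow_add_one, mul_apply, hf, ih]; push_cast; ring
  | pred c ih =>
    rw [zpow_sub_one, mul_apply, ih]
    have : f⁻¹ y = y - b := by rw [inv_eq_iff_eq, hf]; ring
    rw [this]; push_cast; ring

lemma Equiv.Perm.zpow_apply_of_affine {f : Equiv.Perm ℚ} {M b : ℚ} (h0 : M ≠ 0) (h1 : M ≠ 1)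
    (hf : ∀ y, f y = M * y + b) (c : ℤ) (y : ℚ) :
    (f ^ c) y = M ^ c * y + b * (M ^ c - 1) / (M - 1) := by
  have h1' : M - 1 ≠ 0 := sub_ne_zero.2 h1
  induction c generalizing y with
  | zero => simp
  | succ c ih =>
    rw [zpow_add_one, mul_apply, hf, ih, zpow_add_one₀ h0]
    field_simp
    ring
  | pred c ih =>
    have : f⁻¹ y = (y - b) / M := by rw [inv_eq_iff_eq, hf]; field_simp; ring
    rw [zpow_sub_one, mul_apply, this, ih, zpow_sub_one₀ h0]
    field_simp
    ring

namespace BS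

variable {n : ℤ}

/-- The action of `BS(1,n)` on `ℚ` by affine maps, `a` acting as `y ↦ y + 1` and `t` as
`y ↦ n * y`. -/
def affineAction (h0 : (n : ℚ) ≠ 0) : BS n →* Equiv.Perm ℚ :=
  PresentedGroup.toGroup
    (f := fun b => bif b then Equiv.mulLeft₀ (n : ℚ) h0 else Equiv.addRight 1) <| by
    rintro _ rfl
    simp only [map_mul, map_inv, map_zpow, FreeGroup.lift_apply_of, cond_true, cond_false]
    rw [mul_inv_eq_one, mul_assoc, inv_mul_eq_iff_eq_mul]
    ext y
    have h := Equiv.Perm.zpow_apply_of_translation (f := Equiv.addRight (1 : ℚ)) (b := 1)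
      (fun _ => rfl) n
    simp only [Equiv.Perm.mul_apply, h]
    simp [mul_add]

lemma affineAction_a (h0 : (n : ℚ) ≠ 0) (y : ℚ) : affineAction h0 (a n) y = y + 1 := by
  simp [affineAction, a]

lemma affineAction_t (h0 : (n : ℚ) ≠ 0) (y : ℚ) : affineAction h0 (t n) y = n * y := by
  simp [affineAction, t]

lemma affineAction_a_zpow (h0 : (n : ℚ) ≠ 0) (k : ℤ) (y : ℚ) :
    affineAction h0 (a n ^ k) y = y + k := by
  rw [map_zpow, Equiv.Perm.zpow_apply_of_translation (affineAction_a h0), mul_one]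

lemma affineAction_t_zpow (h0 : (n : ℚ) ≠ 0) (h1 : (n : ℚ) ≠ 1) (c : ℤ) (y : ℚ) :
    affineAction h0 (t n ^ c) y = (n : ℚ) ^ c * y := by
  rw [map_zpow, Equiv.Perm.zpow_apply_of_affine (b := 0) h0 h1 (by simpa using affineAction_t h0)]
  simp

lemma affineAction_injective (h0 : (n : ℚ) ≠ 0) (h1 : (n : ℚ) ≠ 1) (h2 : (n : ℚ) ≠ -1) :
    Function.Injective (affineAction h0) := by
  rw [injective_iff_map_eq_one]
  intro g hg
  obtain ⟨p, k, s, rfl⟩ := exists_eq_t_pow_inv_mul_a_zpow_mul_t_pow g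
  have key : ∀ y : ℚ, (n : ℚ) ^ (-(p : ℤ)) * ((n : ℚ) ^ (s : ℤ) * y + k) = y := by
    intro y
    have := DFunLike.congr_fun hg y
    rwa [← zpow_natCast, ← zpow_natCast, ← zpow_neg, map_mul, map_mul, Equiv.Perm.mul_apply,
      Equiv.Perm.mul_apply, affineAction_t_zpow h0 h1, affineAction_t_zpow h0 h1,
      affineAction_a_zpow] at this
  have hk : k = 0 := by
    have := key 0
    simpa [h0] using this
  subst hk
  have hs : (n : ℚ) ^ s = (n : ℚ) ^ p := by
    have := key 1
    rw [zpow_neg, inv_mul_eq_iff_eq_mul₀ (zpow_ne_zero _ h0)] at this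
    simpa using this
  have hsp : s = p := by
    have hn : n.natAbs ^ s = n.natAbs ^ p := by
      rw [← Int.natAbs_pow, ← Int.natAbs_pow]
      congr 1
      exact_mod_cast hs
    refine Nat.pow_right_injective ?_ hn
    have h0' : n ≠ 0 := by exact_mod_cast h0
    have h1' : n ≠ 1 := by exact_mod_cast h1
    have h2' : n ≠ -1 := by exact_mod_cast h2
    omega
  simp [hsp]

lemma affineAction_apow (h0 : (n : ℚ) ≠ 0) (h1 : (n : ℚ) ≠ 1) (k : ℤ) (p : ℕ) (y : ℚ) :
    affineAction h0 (apow n ((k : ℚ) / (n : ℚ) ^ p)) y = y + k / (n : ℚ) ^ p := by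
  have h : ∃ kp : ℤ × ℕ, (k : ℚ) / (n : ℚ) ^ p = (kp.1 : ℚ) / (n : ℚ) ^ kp.2 := ⟨(k, p), rfl⟩
  rw [apow, dif_pos h, map_mul, map_mul, Equiv.Perm.mul_apply, Equiv.Perm.mul_apply,
    affineAction_t_zpow h0 h1, affineAction_t_zpow h0 h1, affineAction_a_zpow, mul_add,
    ← mul_assoc, ← zpow_add₀ h0, neg_add_cancel, zpow_zero, one_mul,
    zpow_neg, zpow_natCast, ← div_eq_inv_mul, ← h.choose_spec]

end BS

/-- a^{m₁} and t^{−r} a^{m₂} t^{r} are ψ^I_{α,β}-twisted conjugate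
(α = k/nʲ, β = ℓ/n^q) iff A·nˣ + B·y = C·n^z has a solution with x ∈ ℕ, y, z ∈ ℤ. -/
theorem typeI_twistedConj_iff_exponential_eq (n : ℤ) (hn : n ∉ ({0, 1, -1} : Set ℤ))
    (k l m₁ m₂ : ℤ) (j q r : ℕ)
    (ψ : BS n →* BS n)
    (ha : ψ (BS.a n) = apow n ((k : ℚ) / (n : ℚ) ^ j))
    (ht : ψ (BS.t n) = apow n ((l : ℚ) / (n : ℚ) ^ q) * BS.t n) :
    twistedConj ψ (BS.a n ^ m₁) (BS.t n ^ (-(r : ℤ)) * BS.a n ^ m₂ * BS.t n ^ (r : ℤ)) ↔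
    ∃ (x : ℕ) (y z : ℤ),
      ((l * n ^ (r + j) + (n - 1) * m₁ * n ^ (r + j + q) : ℤ) : ℚ) * (n : ℚ) ^ x
        + (((n - 1) * (n ^ j - k) * n ^ (r + q) : ℤ) : ℚ) * (y : ℚ)
        = (((n - 1) * m₂ * n ^ (j + q) + l * n ^ (r + j) : ℤ) : ℚ) * (n : ℚ) ^ z := by
  have h0 : (n : ℚ) ≠ 0 := by
    rintro h
    simp [Int.cast_eq_zero.1 h] at hn
  have h1 : (n : ℚ) ≠ 1 := by
    rintro h
    simp [Int.cast_eq_one.1 h] at hn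
  have h2 : (n : ℚ) ≠ -1 := by
    rintro h
    have : n = -1 := by exact_mod_cast h
    simp [this] at hn
  have h1' : (n : ℚ) - 1 ≠ 0 := sub_ne_zero.2 h1
  set φ := BS.affineAction h0 with hφ
  have hψa (c : ℤ) (y : ℚ) : φ (ψ (BS.a n ^ c)) y = y + c * (k / (n : ℚ) ^ j) := by
    rw [map_zpow, map_zpow]
    refine Equiv.Perm.zpow_apply_of_translation (fun y => ?_) c y
    rw [ha, BS.affineAction_apow h0 h1]
  have hψt (c : ℤ) (y : ℚ) : φ (ψ (BS.t n ^ c)) y =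
      (n : ℚ) ^ c * y + l / (n : ℚ) ^ q * ((n : ℚ) ^ c - 1) / (n - 1) := by
    rw [map_zpow, map_zpow]
    refine Equiv.Perm.zpow_apply_of_affine h0 h1 (fun y => ?_) c y
    rw [ht, map_mul, Equiv.Perm.mul_apply, BS.affineAction_apow h0 h1, BS.affineAction_t]
  have key (x : ℕ) (y z : ℤ) :
      BS.t n ^ (-(r : ℤ)) * BS.a n ^ m₂ * BS.t n ^ (r : ℤ) =
          (ψ (BS.t n ^ (-(x : ℤ)) * BS.a n ^ y * BS.t n ^ z))⁻¹ * BS.a n ^ m₁ *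
            (BS.t n ^ (-(x : ℤ)) * BS.a n ^ y * BS.t n ^ z) ↔
        ((l * n ^ (r + j) + (n - 1) * m₁ * n ^ (r + j + q) : ℤ) : ℚ) * (n : ℚ) ^ x
          + (((n - 1) * (n ^ j - k) * n ^ (r + q) : ℤ) : ℚ) * (y : ℚ)
          = (((n - 1) * m₂ * n ^ (j + q) + l * n ^ (r + j) : ℤ) : ℚ) * (n : ℚ) ^ z := by
    rw [mul_assoc _ (BS.a n ^ m₁), eq_inv_mul_iff_mul_eq,
      ← (BS.affineAction_injective h0 h1 h2).eq_iff, Equiv.ext_iff]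
    simp only [map_mul, Equiv.Perm.mul_apply, ← hφ, hψa, hψt]
    simp only [hφ, BS.affineAction_t_zpow h0 h1, BS.affineAction_a_zpow]
    rw [forall_congr' (q := fun _ => _)]
    · exact forall_const ℚ
    intro w
    simp only [zpow_neg, zpow_natCast]
    push_cast
    generalize (n : ℚ) ^ z = Z
    simp only [pow_add]
    field_simp
    constructor <;> intro h <;> linear_combination -h
  constructor
  · rintro ⟨g, hg⟩
    obtain ⟨x, y, s, rfl⟩ := BS.exists_eq_t_pow_inv_mul_a_zpow_mul_t_pow g
    refine ⟨x, y, s, (key x y s).1 ?_⟩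
    simpa only [zpow_neg, zpow_natCast] using hg
  · rintro ⟨x, y, z, h⟩
    exact ⟨_, (key x y z).2 h⟩
end
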